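/- Let m ≥ 1 and λ : ℤ →₀ ZMod m be nonzero, with l := min supp(λ) and r := max supp(λ). If l < 0 < r and both λ(l) and λ(r) are units of ZMod m (i.e., S_λ is bipermutive), then h_alg(S_λ) = (r − l)·log m. -/

import Mathlib

/-- The one-dimensional finitary linear cellular automaton `S_lam` on `ZZ ->0 ZMod m`:
`(S_lam a) n = sum_i lam i * a (n + i)`. -/
noncomputable def SCA (m : ℕ) (lam : ℤ →₀ ZMod m) (a : ℤ →₀ ZMod m) : ℤ →₀ ZMod m :=
  lam.sum fun i c => c • Finsupp.equivMapDomain (Equiv.subRight i) a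

open scoped Pointwise in
/-- The `n`-th trajectory of `F` under `phi`: `T_n(phi,F) = F + phi(F) + ... + phi^(n-1)(F)`
(with `T_0 = {0}`, the empty sum). -/
def Traj {G : Type*} [AddCommGroup G] (φ : G → G) (F : Set G) : ℕ → Set G
  | 0 => {0}
  | n + 1 => Traj φ F n + φ^[n] '' F

/-- The algebraic entropy of an endomorphism of an abelian group: the sup over
nonempty finite subsets `F` of `limsup (log |T_n(phi,F)|) / n`, in extended nonneg. reals. -/
noncomputable def algEntropy {G : Type*} [AddCommGroup G] (φ : G → G) : ENNReal :=
  ⨆ (F : Set G) (_ : F.Finite) (_ : F.Nonempty),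
    Filter.atTop.limsup fun n : ℕ =>
      ENNReal.ofReal (Real.log (Nat.card (Traj φ F n)) / n)

theorem SCA_apply (m : ℕ) (lam a : ℤ →₀ ZMod m) (n : ℤ) :
    SCA m lam a n = ∑ i ∈ lam.support, lam i * a (n + i) := by
  unfold SCA
  rw [Finsupp.sum, Finsupp.finsetSum_apply]
  refine Finset.sum_congr rfl fun i _ => ?_
  simp [Finsupp.equivMapDomain_apply]

theorem SCA_add (m : ℕ) (lam a b : ℤ →₀ ZMod m) :
    SCA m lam (a + b) = SCA m lam a + SCA m lam b := by
  ext n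
  simp [SCA_apply, mul_add, Finset.sum_add_distrib]

theorem SCA_sub (m : ℕ) (lam a b : ℤ →₀ ZMod m) :
    SCA m lam (a - b) = SCA m lam a - SCA m lam b := by
  ext n
  simp [SCA_apply, mul_sub, Finset.sum_sub_distrib]

theorem SCA_zero (m : ℕ) (lam : ℤ →₀ ZMod m) : SCA m lam 0 = 0 := by
  ext n
  simp [SCA_apply]

/-- functions supported in a finset -/
def suppIn (m : ℕ) (s : Finset ℤ) : Set (ℤ →₀ ZMod m) := {f | f.support ⊆ s}

theorem suppIn_eq (m : ℕ) [NeZero m] (s : Finset ℤ) :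
    suppIn m s = ((s.finsupp fun _ => (Finset.univ : Finset (ZMod m))) : Set (ℤ →₀ ZMod m)) := by
  ext f
  simp [suppIn, Finset.mem_finsupp_iff]

theorem suppIn_finite (m : ℕ) [NeZero m] (s : Finset ℤ) : (suppIn m s).Finite := by
  rw [suppIn_eq]; exact Finset.finite_toSet _

theorem suppIn_ncard (m : ℕ) [NeZero m] (s : Finset ℤ) :
    (suppIn m s).ncard = m ^ s.card := by
  rw [suppIn_eq, Set.ncard_coe_finset, Finset.card_finsupp]
  simp [ZMod.card]

theorem suppIn_iff (m : ℕ) (s : Finset ℤ) (f : ℤ →₀ ZMod m) :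
    f ∈ suppIn m s ↔ ∀ n, n ∉ s → f n = 0 := by
  constructor
  · intro h n hn
    by_contra h0
    exact hn (h (Finsupp.mem_support_iff.mpr h0))
  · intro h n hn
    by_contra h0
    exact Finsupp.mem_support_iff.mp hn (h n h0)

theorem SCA_key (m : ℕ) (lam : ℤ →₀ ZMod m) (l r : ℤ)
    (hb : ∀ i ∈ lam.support, l ≤ i ∧ i ≤ r) (hlm : l ∈ lam.support) (hrm : r ∈ lam.support)
    (hl : IsUnit (lam l)) (hr : IsUnit (lam r))
    (t : ℤ →₀ ZMod m) (ht : SCA m lam t ∈ suppIn m (Finset.Ico 0 (r - l))) : t = 0 := by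
  by_contra h0
  have hne := Finsupp.support_nonempty_iff.mpr h0
  set M := t.support.max' hne with hM
  set k := t.support.min' hne with hk
  have hMm : t M ≠ 0 := Finsupp.mem_support_iff.mp (Finset.max'_mem _ hne)
  have hkm : t k ≠ 0 := Finsupp.mem_support_iff.mp (Finset.min'_mem _ hne)
  have hkM : k ≤ M := Finset.min'_le_max' _ hne
  have e1 : SCA m lam t (M - l) = lam l * t M := by
    rw [SCA_apply, Finset.sum_eq_single l]
    · simp
    · intro i hi hil
      have : t (M - l + i) = 0 := by
        by_contra h
        have := Finset.le_max' _ _ (Finsupp.mem_support_iff.mpr h)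
        have := (hb i hi).1
        omega
      simp [this]
    · intro h; exact absurd hlm h
  have e2 : SCA m lam t (k - r) = lam r * t k := by
    rw [SCA_apply, Finset.sum_eq_single r]
    · simp
    · intro i hi hil
      have : t (k - r + i) = 0 := by
        by_contra h
        have := Finset.min'_le _ _ (Finsupp.mem_support_iff.mpr h)
        have := (hb i hi).2
        omega
      simp [this]
    · intro h; exact absurd hrm h
  have f1 : M - l ∈ Finset.Ico 0 (r - l) := by
    apply ht
    rw [Finsupp.mem_support_iff, e1]
    intro h; exact hMm ((hl.mul_right_eq_zero).mp h)
  have f2 : k - r ∈ Finset.Ico 0 (r - l) := by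
    apply ht
    rw [Finsupp.mem_support_iff, e2]
    intro h; exact hkm ((hr.mul_right_eq_zero).mp h)
  rw [Finset.mem_Ico] at f1 f2
  omega

open scoped Pointwise in
theorem Traj_succ' {G : Type*} [AddCommGroup G] (φ : G → G) (h0 : φ 0 = 0)
    (ha : ∀ a b, φ (a + b) = φ a + φ b) (F : Set G) (n : ℕ) :
    Traj φ F (n + 1) = F + φ '' Traj φ F n := by
  induction n with
  | zero => simp [Traj, h0]
  | succ n ih =>
    have h1 : Traj φ F (n + 1 + 1) = Traj φ F (n + 1) + φ^[n+1] '' F := rfl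
    have h2 : Traj φ F (n + 1) = Traj φ F n + φ^[n] '' F := rfl
    have h3 : ∀ A B : Set G, φ '' (A + B) = φ '' A + φ '' B := by
      intro A B
      exact Set.image_image2_distrib ha
    rw [h1, ih, add_assoc, Function.iterate_succ', Set.image_comp, ← h3, ← h2, ih]

open scoped Pointwise in
theorem Traj_card (m : ℕ) [NeZero m] (lam : ℤ →₀ ZMod m) (l r : ℤ)
    (hb : ∀ i ∈ lam.support, l ≤ i ∧ i ≤ r) (hlm : l ∈ lam.support) (hrm : r ∈ lam.support)
    (hl : IsUnit (lam l)) (hr : IsUnit (lam r)) (n : ℕ) :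
    (Traj (SCA m lam) (suppIn m (Finset.Ico 0 (r - l))) n).ncard = (m ^ (r - l).toNat) ^ n := by
  induction n with
  | zero => simp [Traj]
  | succ n ih =>
    rw [Traj_succ' _ (SCA_zero m lam) (SCA_add m lam)]
    set F := suppIn m (Finset.Ico 0 (r - l)) with hF
    set T := Traj (SCA m lam) F n
    have e : F + SCA m lam '' T = (fun p : _ × _ => p.1 + SCA m lam p.2) '' (F ×ˢ T) := by
      ext x
      simp only [Set.mem_add, Set.mem_image, Set.mem_prod, Prod.exists]
      constructor
      · rintro ⟨a, ha, _, ⟨b, hb, rfl⟩, rfl⟩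
        exact ⟨a, b, ⟨ha, hb⟩, rfl⟩
      · rintro ⟨a, b, ⟨ha, hb⟩, rfl⟩
        exact ⟨a, ha, _, ⟨b, hb, rfl⟩, rfl⟩
    rw [e, Set.ncard_image_of_injOn, Set.ncard_prod, ih, hF, suppIn_ncard, Int.card_Ico, sub_zero,
      pow_succ, mul_comm]
    rintro ⟨a, b⟩ ⟨ha, -⟩ ⟨a', b'⟩ ⟨ha', -⟩ hab
    simp only at hab ha ha'
    have h1 : b - b' = 0 := by
      apply SCA_key m lam l r hb hlm hrm hl hr
      have : SCA m lam (b - b') = a' - a := by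
        rw [SCA_sub, sub_eq_sub_iff_add_eq_add, add_comm, hab, add_comm]
        try abel
      rw [this, suppIn_iff]
      intro n hn
      rw [hF, suppIn_iff] at ha ha'
      simp [ha n hn, ha' n hn]
    have h2 : b = b' := sub_eq_zero.mp h1
    subst h2
    simpa using hab

theorem SCA_iter (m : ℕ) (lam : ℤ →₀ ZMod m) (l r : ℤ)
    (hb : ∀ i ∈ lam.support, l ≤ i ∧ i ≤ r) (N : ℤ) (f : ℤ →₀ ZMod m)
    (hf : f ∈ suppIn m (Finset.Icc (-N) N)) (n : ℕ) :
    (SCA m lam)^[n] f ∈ suppIn m (Finset.Icc (-N - n * r) (N - n * l)) := by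
  induction n with
  | zero => simpa using hf
  | succ n ih =>
    rw [Function.iterate_succ_apply']
    rw [suppIn_iff] at ih ⊢
    intro k hk
    rw [SCA_apply]
    refine Finset.sum_eq_zero fun i hi => ?_
    rw [ih, mul_zero]
    intro h
    apply hk
    rw [Finset.mem_Icc] at h ⊢
    have := hb i hi
    push_cast
    constructor <;> linarith [h.1, h.2]

theorem Traj_sub (m : ℕ) (lam : ℤ →₀ ZMod m) (l r : ℤ) (hl0 : l < 0) (hr0 : 0 < r)
    (hb : ∀ i ∈ lam.support, l ≤ i ∧ i ≤ r) (N : ℤ) (F : Set (ℤ →₀ ZMod m))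
    (hF : F ⊆ suppIn m (Finset.Icc (-N) N)) (n : ℕ) :
    Traj (SCA m lam) F n ⊆ suppIn m (Finset.Icc (-N - n * r) (N - n * l)) := by
  induction n with
  | zero =>
    intro x hx
    have : x = 0 := hx
    subst this
    simp [suppIn]
  | succ n ih =>
    rintro _ ⟨a, ha, _, ⟨b, hb', rfl⟩, rfl⟩
    have h1 := ih ha
    have h2 := SCA_iter m lam l r hb N b (hF hb') n
    rw [suppIn_iff] at h1 h2 ⊢
    intro k hk
    have : k ∉ Finset.Icc (-N - n * r) (N - n * l) := by
      intro h
      apply hk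
      rw [Finset.mem_Icc] at h ⊢
      push_cast
      constructor <;> linarith [h.1, h.2]
    simp [h1 k this, h2 k this]

theorem exists_bound (m : ℕ) (F : Set (ℤ →₀ ZMod m)) (hF : F.Finite) :
    ∃ N : ℕ, F ⊆ suppIn m (Finset.Icc (-(N : ℤ)) N) := by
  classical
  refine ⟨(hF.toFinset.biUnion fun f => f.support).sup Int.natAbs, fun f hf k hk => ?_⟩
  have : k.natAbs ≤ (hF.toFinset.biUnion fun f => f.support).sup Int.natAbs := by
    apply Finset.le_sup (f := Int.natAbs)
    rw [Finset.mem_biUnion]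
    exact ⟨f, by simpa using hf, hk⟩
  rw [Finset.mem_Icc]
  omega

theorem aux_main (m : ℕ) (hm : 1 ≤ m) (lam : ℤ →₀ ZMod m) (l r : ℤ) (hl0 : l < 0) (hr0 : 0 < r)
    (hb : ∀ i ∈ lam.support, l ≤ i ∧ i ≤ r) (hlm : l ∈ lam.support) (hrm : r ∈ lam.support)
    (hl : IsUnit (lam l)) (hr : IsUnit (lam r)) :
    algEntropy (SCA m lam) = ENNReal.ofReal (((r : ℝ) - (l : ℝ)) * Real.log m) := by
  haveI : NeZero m := ⟨by omega⟩
  have hd : ((r - l).toNat : ℝ) = (r : ℝ) - l := by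
    have : ((r - l).toNat : ℤ) = r - l := Int.toNat_of_nonneg (by omega)
    exact_mod_cast congrArg (Int.cast : ℤ → ℝ) this
  apply le_antisymm
  · unfold algEntropy
    refine iSup_le fun F => iSup_le fun hF => iSup_le fun hne => ?_
    obtain ⟨N, hN⟩ := exists_bound m F hF
    have hlim : Filter.Tendsto (fun n : ℕ => ENNReal.ofReal
        ((2 * N + 1) * Real.log m / n + ((r : ℝ) - l) * Real.log m)) Filter.atTop
        (nhds (ENNReal.ofReal (((r : ℝ) - l) * Real.log m))) := by
      apply ENNReal.tendsto_ofReal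
      have := (tendsto_const_div_atTop_nhds_zero_nat ((2 * N + 1) * Real.log m)).add_const
        (((r : ℝ) - l) * Real.log m)
      simpa using this
    rw [← hlim.limsup_eq]
    refine Filter.limsup_le_limsup ?_
    · filter_upwards [Filter.eventually_gt_atTop 0] with n hn
      apply ENNReal.ofReal_le_ofReal
      have hsub := Traj_sub m lam l r hl0 hr0 hb N F hN n
      have hcard := Set.ncard_le_ncard hsub (suppIn_finite m _)
      rw [suppIn_ncard, Int.card_Icc] at hcard
      have hn' : (0 : ℝ) < n := by exact_mod_cast hn
      have hlog : Real.log (Nat.card (Traj (SCA m lam) F n)) ≤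
          ((2 * N + 1) + n * ((r : ℝ) - l)) * Real.log m := by
        have hx : (((N : ℤ) - n * l + 1 - (-N - n * r)).toNat : ℝ)
            = (2 * N + 1) + n * ((r : ℝ) - l) := by
          have : (((N : ℤ) - n * l + 1 - (-N - n * r)).toNat : ℤ)
              = (N : ℤ) - n * l + 1 - (-N - n * r) := Int.toNat_of_nonneg (by nlinarith)
          have := congrArg (Int.cast : ℤ → ℝ) this
          push_cast at this ⊢
          rw [this]; ring
        rw [← hx, ← Real.log_pow]
        rcases Nat.eq_zero_or_pos (Nat.card (Traj (SCA m lam) F n)) with h | h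
        · rw [h]
          simp only [Nat.cast_zero, Real.log_zero]
          apply Real.log_nonneg
          exact one_le_pow₀ (by exact_mod_cast hm)
        · apply Real.log_le_log (by exact_mod_cast h)
          exact_mod_cast hcard
      rw [div_le_iff₀ hn']
      refine hlog.trans (le_of_eq ?_)
      field_simp
  · unfold algEntropy
    refine le_iSup_of_le (suppIn m (Finset.Ico 0 (r - l))) (le_iSup_of_le (suppIn_finite m _)
      (le_iSup_of_le ⟨0, by simp [suppIn]⟩ ?_))
    have hlim : Filter.Tendsto (fun n : ℕ => ENNReal.ofReal (Real.log
        (Nat.card (Traj (SCA m lam) (suppIn m (Finset.Ico 0 (r - l))) n)) / n)) Filter.atTop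
        (nhds (ENNReal.ofReal (((r : ℝ) - l) * Real.log m))) := by
      refine tendsto_const_nhds.congr' ?_
      filter_upwards [Filter.eventually_gt_atTop 0] with n hn
      have hn' : (n : ℝ) ≠ 0 := by exact_mod_cast hn.ne'
      have hc := Traj_card m lam l r hb hlm hrm hl hr n
      rw [Set.ncard_def, Set.encard] at hc
      have hc' : Nat.card (Traj (SCA m lam) (suppIn m (Finset.Ico 0 (r - l))) n)
        = (m ^ (r - l).toNat) ^ n := hc
      rw [hc']
      push_cast
      rw [Real.log_pow, Real.log_pow, hd]
      field_simp
    exact hlim.limsup_eq.ge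

theorem stmt13 (m : ℕ) (hm : 1 ≤ m) (lam : ℤ →₀ ZMod m) (hlam : lam ≠ 0)
    (hl0 : lam.support.min' (Finsupp.support_nonempty_iff.mpr hlam) < 0)
    (hr0 : 0 < lam.support.max' (Finsupp.support_nonempty_iff.mpr hlam))
    (hl : IsUnit (lam (lam.support.min' (Finsupp.support_nonempty_iff.mpr hlam))))
    (hr : IsUnit (lam (lam.support.max' (Finsupp.support_nonempty_iff.mpr hlam)))) :
    algEntropy (SCA m lam)
      = ENNReal.ofReal
          ((((lam.support.max' (Finsupp.support_nonempty_iff.mpr hlam) : ℤ) : ℝ)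
              - ((lam.support.min' (Finsupp.support_nonempty_iff.mpr hlam) : ℤ) : ℝ))
            * Real.log m) := by
  exact aux_main m hm lam _ _ hl0 hr0
    (fun i hi => ⟨Finset.min'_le _ _ hi, Finset.le_max' _ _ hi⟩)
    (Finset.min'_mem _ _) (Finset.max'_mem _ _) hl hr
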